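/- arXiv:1402.6806 — 6 statements merged into one kernel-verified Lean document; each statement's English description precedes it below -/
import Mathlib

section
/- Let L : ℝ → ℝ satisfy conditions (C1) and (C2), let m ≥ 1 and r ≥ 1, let φ_1, …, φ_r ∈ ℝ^m be arbitrary vectors, and let y ∈ ℝ^m. If θ = (θ_1, …, θ_r) ∈ ℝ^r is a global minimizer of the function θ ↦ ∑_{j=1}^m L(y_j − ∑_{k=1}^r θ_k φ_{kj}), then for every j ∈ {1, …, m} the fitted value satisfies |∑_{k=1}^r θ_k φ_{kj}| ≤ 2 ∑_{l=1}^m |y_l|. -/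
/-- If `L` satisfies (C1) and (C2) and `θ` is a global minimizer of the
robust fitting objective, then every fitted value is bounded by twice the
ℓ¹ norm of `y`. -/
theorem fitted_value_bound
    (L : ℝ → ℝ)
    -- (C1)
    (hEven : ∀ x : ℝ, L (-x) = L x)
    (hNonneg : ∀ x : ℝ, 0 ≤ L x)
    (hZero : ∀ x : ℝ, L x = 0 ↔ x = 0)
    -- (C2)
    (hDiff : Differentiable ℝ L)
    (hDerivCont : Continuous (deriv L))
    (hDerivMono : Monotone (deriv L))
    (hDerivPos : ∀ x : ℝ, 0 < x → 0 < deriv L x)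
    (m r : ℕ) (hm : 1 ≤ m) (hr : 1 ≤ r)
    (φ : Fin r → Fin m → ℝ) (y : Fin m → ℝ)
    (θ : Fin r → ℝ)
    (hmin : ∀ θ' : Fin r → ℝ,
      ∑ j, L (y j - ∑ k, θ k * φ k j) ≤ ∑ j, L (y j - ∑ k, θ' k * φ k j)) :
    ∀ j : Fin m, |∑ k, θ k * φ k j| ≤ 2 * ∑ l, |y l| := by
  have hconv : ConvexOn ℝ Set.univ L := hDerivMono.convexOn_univ_of_deriv hDiff
  have hL0 : L 0 = 0 := (hZero 0).2 rfl
  have hLabs : ∀ x, L |x| = L x := by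
    intro x
    rcases abs_choice x with h | h <;> rw [h]
    exact hEven x
  have hstrict : StrictMonoOn L (Set.Ici 0) := by
    apply strictMonoOn_of_deriv_pos (convex_Ici 0) hDiff.continuous.continuousOn
    intro x hx
    rw [interior_Ici] at hx
    exact hDerivPos x hx
  intro j
  set S := ∑ l, |y l| with hS
  have hS0 : 0 ≤ S := Finset.sum_nonneg fun l _ => abs_nonneg _
  have hyS : ∀ l, |y l| ≤ S := fun l =>
    Finset.single_le_sum (f := fun l => |y l|) (fun l _ => abs_nonneg _) (Finset.mem_univ l)
  have hsum : ∑ l, L (y l) ≤ L S := by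
    rcases hS0.eq_or_lt with h | h
    · have : ∀ l, L (y l) = 0 := by
        intro l
        rw [hZero, ← abs_nonpos_iff]
        exact (hyS l).trans h.symm.le
      simp [this, hNonneg]
    · have hb : ∀ l, L (y l) ≤ |y l| / S * L S := by
        intro l
        have h1 : |y l| / S ≤ 1 := (div_le_one h).2 (hyS l)
        have h2 := hconv.2 (Set.mem_univ S) (Set.mem_univ 0)
          (div_nonneg (abs_nonneg (y l)) hS0) (sub_nonneg.2 h1) (by ring)
        simp only [smul_eq_mul, mul_zero, add_zero, hL0] at h2
        rwa [div_mul_cancel₀ _ h.ne', hLabs] at h2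
      calc ∑ l, L (y l) ≤ ∑ l, |y l| / S * L S := Finset.sum_le_sum fun l _ => hb l
        _ = L S := by
          rw [← Finset.sum_mul, ← Finset.sum_div, ← hS, div_self h.ne', one_mul]
  have h0 := hmin 0
  simp only [Pi.zero_apply, zero_mul, Finset.sum_const_zero, sub_zero] at h0
  have hj : L (y j - ∑ k, θ k * φ k j) ≤ L S :=
    (Finset.single_le_sum (f := fun j => L (y j - ∑ k, θ k * φ k j))
      (fun l _ => hNonneg _) (Finset.mem_univ j)).trans (h0.trans hsum)
  rw [← hLabs] at hj
  have hr1 := (hstrict.le_iff_le (Set.mem_Ici.2 (abs_nonneg _)) (Set.mem_Ici.2 hS0)).1 hj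
  have := hyS j
  rw [abs_le] at *
  constructor <;> linarith [hr1.1, hr1.2, this.1, this.2]
end

section
/- Let L : ℝ → ℝ satisfy conditions (C1) and (C2), let m ≥ 1 and r ≥ 1, let φ_1, …, φ_r ∈ ℝ^m be orthonormal vectors, and let y ∈ ℝ^m. If θ = (θ_1, …, θ_r) ∈ ℝ^r is a global minimizer of the function θ ↦ ∑_{j=1}^m L(y_j − ∑_{k=1}^r θ_k φ_{kj}), then ∑_{k=1}^r θ_k^2 ≤ 4 m^2 ‖y‖^2, where ‖·‖ is the Euclidean norm on ℝ^m. -/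
/-- First assertion of Lemma B.5: for `L` satisfying (C1) and (C2) and
orthonormal column vectors `φ_1, …, φ_r`, any global minimizer `θ` of the
robust fitting objective satisfies `∑ k θ_k² ≤ 4 m² ‖y‖²`. -/
theorem minimizer_sq_norm_bound
    (L : ℝ → ℝ)
    -- (C1)
    (hEven : ∀ x : ℝ, L (-x) = L x)
    (hNonneg : ∀ x : ℝ, 0 ≤ L x)
    (hZero : ∀ x : ℝ, L x = 0 ↔ x = 0)
    -- (C2)
    (hDiff : Differentiable ℝ L)
    (hDerivCont : Continuous (deriv L))
    (hDerivMono : Monotone (deriv L))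
    (hDerivPos : ∀ x : ℝ, 0 < x → 0 < deriv L x)
    (m r : ℕ) (hm : 1 ≤ m) (hr : 1 ≤ r)
    (φ : Fin r → EuclideanSpace ℝ (Fin m))
    (hortho : Orthonormal ℝ φ)
    (y : EuclideanSpace ℝ (Fin m))
    (θ : Fin r → ℝ)
    (hmin : ∀ θ' : Fin r → ℝ,
      ∑ j, L (y j - ∑ k, θ k * φ k j) ≤ ∑ j, L (y j - ∑ k, θ' k * φ k j)) :
    ∑ k, (θ k) ^ 2 ≤ 4 * (m : ℝ) ^ 2 * ‖y‖ ^ 2 := by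
  have habs : ∀ x : ℝ, L |x| = L x := by
    intro x
    rcases abs_choice x with h | h <;> rw [h]
    exact hEven x
  have hconv : ConvexOn ℝ Set.univ L := hDerivMono.convexOn_univ_of_deriv hDiff
  have hstrict : StrictMonoOn L (Set.Ici 0) := by
    apply strictMonoOn_of_deriv_pos (convex_Ici 0) hDiff.continuous.continuousOn
    intro x hx
    rw [interior_Ici] at hx
    exact hDerivPos x hx
  have hm0 : (0 : ℝ) < m := by exact_mod_cast hm
  have hm1 : (1 : ℝ) ≤ m := by exact_mod_cast hm
  set v : EuclideanSpace ℝ (Fin m) := ∑ k, θ k • φ k with hv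
  have hvj : ∀ j, v j = ∑ k, θ k * φ k j := by
    intro j
    simp [hv]
  have hvn : ‖v‖ ^ 2 = ∑ k, θ k ^ 2 := by
    rw [← real_inner_self_eq_norm_sq, hv, hortho.inner_sum]
    simp [sq]
  set u := y - v with hu
  have huj : ∀ j, u j = y j - ∑ k, θ k * φ k j := by
    intro j
    rw [← hvj]; rfl
  have h0 : ∑ j, L (u j) ≤ ∑ j, L (y j) := by
    have := hmin 0
    simpa [huj] using this
  have h1 : ∑ j, L (y j) ≤ m * L ‖y‖ := by
    have : ∀ j ∈ Finset.univ, L (y j) ≤ L ‖y‖ := by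
      intro j _
      rw [← habs (y j)]
      apply hstrict.monotoneOn (Set.mem_Ici.2 (abs_nonneg _)) (Set.mem_Ici.2 (norm_nonneg _))
      simpa using PiLp.norm_apply_le y j
    simpa using Finset.sum_le_sum this
  have h2 : L (∑ j, (m : ℝ)⁻¹ * |u j|) ≤ ∑ j, (m : ℝ)⁻¹ * L (u j) := by
    have := hconv.map_sum_le (t := Finset.univ) (w := fun _ : Fin m => (m : ℝ)⁻¹)
      (p := fun j => |u j|) (fun _ _ => by positivity)
      (by simp [hm0.ne']) (fun _ _ => Set.mem_univ _)
    simpa [habs] using this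
  rw [← Finset.mul_sum, ← Finset.mul_sum] at h2
  have h3 : L ((m : ℝ)⁻¹ * ∑ j, |u j|) ≤ L ‖y‖ := by
    refine h2.trans ?_
    rw [inv_mul_le_iff₀ hm0]
    exact h0.trans h1
  have hS : 0 ≤ ∑ j, |u j| := Finset.sum_nonneg fun _ _ => abs_nonneg _
  have h4 : (m : ℝ)⁻¹ * ∑ j, |u j| ≤ ‖y‖ :=
    (hstrict.le_iff_le (Set.mem_Ici.2 (by positivity)) (norm_nonneg y)).1 h3
  rw [inv_mul_le_iff₀ hm0] at h4
  have h5 : ‖u‖ ≤ ∑ j, |u j| := by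
    refine (abs_le_of_sq_le_sq' ?_ hS).2
    rw [EuclideanSpace.norm_sq_eq]
    simpa using Finset.sum_sq_le_sq_sum_of_nonneg (s := Finset.univ) (f := fun j => |u j|) (fun _ _ => abs_nonneg _)
  have h6 : ‖v‖ ≤ 2 * m * ‖y‖ := by
    have e : v = y - u := by simp [hu]
    have := norm_sub_le y u
    rw [← e] at this
    nlinarith [norm_nonneg y]
  rw [← hvn]
  calc ‖v‖ ^ 2 ≤ (2 * m * ‖y‖) ^ 2 := by gcongr
    _ = _ := by ring
end

section
/- Let m ≥ 1 and let φ_1^{(1)}, φ_2^{(1)} ∈ ℝ^m be orthonormal and φ_1^{(2)}, φ_2^{(2)} ∈ ℝ^m be orthonormal. Let 0 < τ < 2/3 satisfy ‖φ_1^{(1)} − φ_1^{(2)}‖^2 + ‖φ_2^{(1)} − φ_2^{(2)}‖^2 ≤ τ^2, let λ ∈ (0, 1), and set φ_k^* = λ φ_k^{(1)} + (1 − λ) φ_k^{(2)} for k = 1, 2. Then for all real numbers a, b, one has ‖a φ_1^* + b φ_2^*‖^2 ≥ (1 − 3τ/2)(a^2 + b^2), where ‖·‖ is the Euclidean norm on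 ℝ^m. -/
open scoped RealInnerProductSpace

/-- Quadratic-form lower bound from the proof of Lemma B.5: for convex
combinations `φ_k* = λ φ_k^{(1)} + (1-λ) φ_k^{(2)}` of two nearby orthonormal
pairs, `‖a φ_1* + b φ_2*‖² ≥ (1 - 3τ/2)(a² + b²)`. -/
theorem convex_combination_quadratic_lower_bound
    (m : ℕ) (hm : 1 ≤ m)
    (φ11 φ21 φ12 φ22 : EuclideanSpace ℝ (Fin m))
    (h11 : ‖φ11‖ = 1) (h21 : ‖φ21‖ = 1) (h1orth : ⟪φ11, φ21⟫ = 0)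
    (h12 : ‖φ12‖ = 1) (h22 : ‖φ22‖ = 1) (h2orth : ⟪φ12, φ22⟫ = 0)
    (τ : ℝ) (hτ0 : 0 < τ) (hτ : τ < 2 / 3)
    (hclose : ‖φ11 - φ12‖ ^ 2 + ‖φ21 - φ22‖ ^ 2 ≤ τ ^ 2)
    (lam : ℝ) (hlam0 : 0 < lam) (hlam1 : lam < 1) :
    ∀ a b : ℝ,
      (1 - 3 * τ / 2) * (a ^ 2 + b ^ 2) ≤
        ‖a • (lam • φ11 + (1 - lam) • φ12) +
          b • (lam • φ21 + (1 - lam) • φ22)‖ ^ 2 := by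
  intro a b
  have norm_pair : ∀ x y : EuclideanSpace ℝ (Fin m), ‖x‖ = 1 → ‖y‖ = 1 → ⟪x, y⟫ = 0 →
      ‖a • x + b • y‖ ^ 2 = a ^ 2 + b ^ 2 := by
    intro x y hx hy hxy
    rw [norm_add_sq_real, norm_smul, norm_smul, real_inner_smul_left, real_inner_smul_right,
      hx, hy, hxy]
    simp
  have hu := norm_pair φ11 φ21 h11 h21 h1orth
  have hv := norm_pair φ12 φ22 h12 h22 h2orth
  -- Lagrange identity
  have hlag : ∀ d e : EuclideanSpace ℝ (Fin m),
      ‖a • d + b • e‖ ^ 2 + ‖b • d - a • e‖ ^ 2 = (a ^ 2 + b ^ 2) * (‖d‖ ^ 2 + ‖e‖ ^ 2) := by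
    intro d e
    rw [norm_add_sq_real, norm_sub_sq_real]
    simp only [norm_smul, real_inner_smul_left, real_inner_smul_right, mul_pow,
      Real.norm_eq_abs, sq_abs]
    ring
  have hconv : ∀ u v : EuclideanSpace ℝ (Fin m),
      ‖lam • u + (1 - lam) • v‖ ^ 2 =
        lam * ‖u‖ ^ 2 + (1 - lam) * ‖v‖ ^ 2 - lam * (1 - lam) * ‖u - v‖ ^ 2 := by
    intro u v
    rw [norm_add_sq_real, norm_sub_sq_real]
    simp only [norm_smul, real_inner_smul_left, real_inner_smul_right, mul_pow,
      Real.norm_eq_abs, sq_abs]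
    ring
  have e1 : a • (lam • φ11 + (1 - lam) • φ12) + b • (lam • φ21 + (1 - lam) • φ22)
      = lam • (a • φ11 + b • φ21) + (1 - lam) • (a • φ12 + b • φ22) := by module
  have e2 : (a • φ11 + b • φ21) - (a • φ12 + b • φ22)
      = a • (φ11 - φ12) + b • (φ21 - φ22) := by module
  rw [e1, hconv, hu, hv, e2]
  have hs : 0 ≤ a ^ 2 + b ^ 2 := by positivity
  have hD : ‖a • (φ11 - φ12) + b • (φ21 - φ22)‖ ^ 2 ≤ (a ^ 2 + b ^ 2) * τ ^ 2 := by
    have h := hlag (φ11 - φ12) (φ21 - φ22)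
    have h2 := mul_le_mul_of_nonneg_left hclose hs
    have h3 := sq_nonneg ‖b • (φ11 - φ12) - a • (φ21 - φ22)‖
    linarith
  have hq : lam * (1 - lam) ≤ 1 / 4 := by nlinarith [sq_nonneg (lam - 1 / 2)]
  have hm1 := mul_le_mul hq hD (sq_nonneg _) (by norm_num)
  have ht : τ ^ 2 / 4 ≤ 3 * τ / 2 := by nlinarith
  have h4 := mul_le_mul_of_nonneg_left ht hs
  linarith
end

section
/- Let L : ℝ → ℝ satisfy conditions (C1) and (C2), let m ≥ 1, let φ_1^{(1)}, φ_2^{(1)} ∈ ℝ^m be orthonormal and φ_1^{(2)}, φ_2^{(2)} ∈ ℝ^m be orthonormal, let 0 < τ < 2/3 satisfy ‖φ_1^{(1)} − φ_1^{(2)}‖^2 + ‖φ_2^{(1)} − φ_2^{(2)}‖^2 ≤ τ^2, let λ ∈ (0, 1), and set φ_k^* = λ φ_k^{(1)} + (1 − λ) φ_k^{(2)} for k = 1, 2. If (a, b) ∈ ℝ^2 is a global minimizer of (θ_1, θ_2) ↦ ∑_{j=1}^m L(y_j − θ_1 φ_{1j}^* − θ_2 φ_{2j}^*) for a given y ∈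 ℝ^m, then a^2 + b^2 ≤ 4 m^3 (1 − 3τ/2)^{−1} ‖y‖^2, where ‖·‖ is the Euclidean norm on ℝ^m. -/
open scoped RealInnerProductSpace

theorem aux_orth {m : ℕ} (u v : EuclideanSpace ℝ (Fin m)) (a b : ℝ)
    (hu : ‖u‖ = 1) (hv : ‖v‖ = 1) (h : ⟪u, v⟫ = 0) :
    ‖a • u + b • v‖ ^ 2 = a ^ 2 + b ^ 2 := by
  rw [norm_add_sq_real, real_inner_smul_left, real_inner_smul_right, h, norm_smul, norm_smul,
    hu, hv]
  simp

theorem aux_comb {m : ℕ} (u v : EuclideanSpace ℝ (Fin m)) (l : ℝ) :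
    ‖l • u + (1 - l) • v‖ ^ 2 =
      l * ‖u‖ ^ 2 + (1 - l) * ‖v‖ ^ 2 - l * (1 - l) * ‖u - v‖ ^ 2 := by
  rw [norm_add_sq_real, norm_sub_sq_real, real_inner_smul_left, real_inner_smul_right,
    norm_smul, norm_smul, mul_pow, mul_pow, Real.norm_eq_abs, Real.norm_eq_abs, sq_abs, sq_abs]
  ring

theorem aux_cs {m : ℕ} (u v : EuclideanSpace ℝ (Fin m)) (a b : ℝ) :
    ‖a • u + b • v‖ ^ 2 ≤ (a ^ 2 + b ^ 2) * (‖u‖ ^ 2 + ‖v‖ ^ 2) := by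
  have h := norm_add_le (a • u) (b • v)
  rw [norm_smul, norm_smul, Real.norm_eq_abs, Real.norm_eq_abs] at h
  have h2 := pow_le_pow_left₀ (norm_nonneg _) h 2
  rw [← sq_abs a, ← sq_abs b]
  nlinarith [sq_nonneg (|a| * ‖v‖ - |b| * ‖u‖)]

/-- Second assertion of Lemma B.5: for `L` satisfying (C1) and (C2) and
column vectors given by convex combinations of two nearby orthonormal pairs,
any global minimizer `(a, b)` of the robust fitting objective satisfies
`a² + b² ≤ 4 m³ (1 - 3τ/2)⁻¹ ‖y‖²`. -/
theorem minimizer_bound_convex_combination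
    (L : ℝ → ℝ)
    -- (C1)
    (hEven : ∀ x : ℝ, L (-x) = L x)
    (hNonneg : ∀ x : ℝ, 0 ≤ L x)
    (hZero : ∀ x : ℝ, L x = 0 ↔ x = 0)
    -- (C2)
    (hDiff : Differentiable ℝ L)
    (hDerivCont : Continuous (deriv L))
    (hDerivMono : Monotone (deriv L))
    (hDerivPos : ∀ x : ℝ, 0 < x → 0 < deriv L x)
    (m : ℕ) (hm : 1 ≤ m)
    (φ11 φ21 φ12 φ22 : EuclideanSpace ℝ (Fin m))
    (h11 : ‖φ11‖ = 1) (h21 : ‖φ21‖ = 1) (h1orth : ⟪φ11, φ21⟫ = 0)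
    (h12 : ‖φ12‖ = 1) (h22 : ‖φ22‖ = 1) (h2orth : ⟪φ12, φ22⟫ = 0)
    (τ : ℝ) (hτ0 : 0 < τ) (hτ : τ < 2 / 3)
    (hclose : ‖φ11 - φ12‖ ^ 2 + ‖φ21 - φ22‖ ^ 2 ≤ τ ^ 2)
    (lam : ℝ) (hlam0 : 0 < lam) (hlam1 : lam < 1)
    (φstar1 φstar2 : EuclideanSpace ℝ (Fin m))
    (hφ1 : φstar1 = lam • φ11 + (1 - lam) • φ12)
    (hφ2 : φstar2 = lam • φ21 + (1 - lam) • φ22)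
    (y : EuclideanSpace ℝ (Fin m))
    (a b : ℝ)
    (hmin : ∀ θ1 θ2 : ℝ,
      ∑ j, L (y j - a * φstar1 j - b * φstar2 j) ≤
        ∑ j, L (y j - θ1 * φstar1 j - θ2 * φstar2 j)) :
    a ^ 2 + b ^ 2 ≤ 4 * (m : ℝ) ^ 3 * (1 - 3 * τ / 2)⁻¹ * ‖y‖ ^ 2 := by
  set v : EuclideanSpace ℝ (Fin m) := a • φstar1 + b • φstar2 with hv
  have hm' : (1 : ℝ) ≤ m := by exact_mod_cast hm
  -- lower bound on ‖v‖
  have hlow : (1 - 3 * τ / 2) * (a ^ 2 + b ^ 2) ≤ ‖v‖ ^ 2 := by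
    have e : v = lam • (a • φ11 + b • φ21) + (1 - lam) • (a • φ12 + b • φ22) := by
      rw [hv, hφ1, hφ2]; module
    have e2 : (a • φ11 + b • φ21) - (a • φ12 + b • φ22)
        = a • (φ11 - φ12) + b • (φ21 - φ22) := by module
    rw [e, aux_comb, aux_orth _ _ _ _ h11 h21 h1orth, aux_orth _ _ _ _ h12 h22 h2orth, e2]
    have h1 := aux_cs (φ11 - φ12) (φ21 - φ22) a b
    have h2 : (a ^ 2 + b ^ 2) * (‖φ11 - φ12‖ ^ 2 + ‖φ21 - φ22‖ ^ 2)
        ≤ (a ^ 2 + b ^ 2) * τ ^ 2 := mul_le_mul_of_nonneg_left hclose (by positivity)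
    have h3 : lam * (1 - lam) ≤ 1 / 4 := by nlinarith [sq_nonneg (lam - 1 / 2)]
    have h4 : lam * (1 - lam) * ‖a • (φ11 - φ12) + b • (φ21 - φ22)‖ ^ 2
        ≤ 1 / 4 * ((a ^ 2 + b ^ 2) * τ ^ 2) :=
      mul_le_mul h3 (h1.trans h2) (by positivity) (by norm_num)
    have h5 : (a ^ 2 + b ^ 2) * τ ^ 2 ≤ (a ^ 2 + b ^ 2) * τ :=
      mul_le_mul_of_nonneg_left (by nlinarith) (by positivity)
    have h6 : 0 ≤ (a ^ 2 + b ^ 2) * τ := by positivity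
    nlinarith
  -- properties of L
  have hL0 : L 0 = 0 := (hZero 0).2 rfl
  have hstrict : StrictMonoOn L (Set.Ici 0) := by
    apply strictMonoOn_of_deriv_pos (convex_Ici 0) hDiff.continuous.continuousOn
    intro x hx
    rw [interior_Ici] at hx
    exact hDerivPos x hx
  have habs : ∀ x, L |x| = L x := by
    intro x
    rcases abs_choice x with h | h <;> rw [h]
    exact hEven x
  have hconv : ConvexOn ℝ Set.univ L := hDerivMono.convexOn_univ_of_deriv hDiff
  have hscale : (m : ℝ) * L ‖y‖ ≤ L (m * ‖y‖) := by
    have hpos : (0 : ℝ) < m := by linarith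
    have h := hconv.2 (Set.mem_univ ((m : ℝ) * ‖y‖)) (Set.mem_univ (0 : ℝ))
      (show (0 : ℝ) ≤ (m : ℝ)⁻¹ by positivity)
      (show (0 : ℝ) ≤ 1 - (m : ℝ)⁻¹ by have := inv_le_one_of_one_le₀ hm'; linarith) (by ring)
    simp only [smul_eq_mul, mul_zero, add_zero, hL0] at h
    rw [inv_mul_cancel_left₀ hpos.ne'] at h
    calc (m : ℝ) * L ‖y‖ ≤ m * ((m : ℝ)⁻¹ * L (m * ‖y‖)) :=
          mul_le_mul_of_nonneg_left h hpos.le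
      _ = _ := mul_inv_cancel_left₀ hpos.ne' _
  have hyj : ∀ j, |y j| ≤ ‖y‖ := fun j => by
    simpa [Real.norm_eq_abs] using PiLp.norm_apply_le y j
  have hsum : ∑ j, L (y j - a * φstar1 j - b * φstar2 j) ≤ m * L ‖y‖ := by
    refine (hmin 0 0).trans ?_
    calc ∑ j, L (y j - 0 * φstar1 j - 0 * φstar2 j) ≤ ∑ _j : Fin m, L ‖y‖ := by
          apply Finset.sum_le_sum
          intro j _
          rw [zero_mul, zero_mul, sub_zero, sub_zero, ← habs]
          exact hstrict.monotoneOn (Set.mem_Ici.2 (abs_nonneg _)) (Set.mem_Ici.2 (norm_nonneg y)) (hyj j)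
      _ = _ := by simp
  have hvj : ∀ j, (v j) ^ 2 ≤ (2 * m * ‖y‖) ^ 2 := by
    intro j
    have e : v j = a * φstar1 j + b * φstar2 j := by simp [hv]
    have h1 : L (y j - v j) ≤ L (m * ‖y‖) := by
      refine le_trans ?_ (hsum.trans hscale)
      have := Finset.single_le_sum
        (f := fun j => L (y j - a * φstar1 j - b * φstar2 j))
        (fun i _ => hNonneg _) (Finset.mem_univ j)
      rw [e, ← sub_sub]
      exact this
    rw [← habs] at h1
    have h2 : |y j - v j| ≤ m * ‖y‖ :=
      (hstrict.le_iff_le (Set.mem_Ici.2 (abs_nonneg _)) (by simp only [Set.mem_Ici]; positivity)).1 h1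
    have h3 := hyj j
    have h4 : ‖y‖ ≤ m * ‖y‖ := le_mul_of_one_le_left (norm_nonneg y) hm'
    apply sq_le_sq'
    · linarith [(abs_le.1 h2).1, (abs_le.1 h2).2, (abs_le.1 h3).1, (abs_le.1 h3).2]
    · linarith [(abs_le.1 h2).1, (abs_le.1 h2).2, (abs_le.1 h3).1, (abs_le.1 h3).2]
  have hup : ‖v‖ ^ 2 ≤ 4 * (m : ℝ) ^ 3 * ‖y‖ ^ 2 := by
    rw [EuclideanSpace.real_norm_sq_eq v]
    calc ∑ j, (v j) ^ 2 ≤ ∑ _j : Fin m, (2 * m * ‖y‖) ^ 2 :=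
          Finset.sum_le_sum fun j _ => hvj j
      _ = 4 * (m : ℝ) ^ 3 * ‖y‖ ^ 2 := by simp; ring
  have hc : 0 < 1 - 3 * τ / 2 := by linarith
  calc a ^ 2 + b ^ 2 = (1 - 3 * τ / 2)⁻¹ * ((1 - 3 * τ / 2) * (a ^ 2 + b ^ 2)) :=
        (inv_mul_cancel_left₀ hc.ne' _).symm
    _ ≤ (1 - 3 * τ / 2)⁻¹ * (4 * (m : ℝ) ^ 3 * ‖y‖ ^ 2) :=
        mul_le_mul_of_nonneg_left (hlow.trans hup) (by positivity)
    _ = _ := by ring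
end

section
/- Let L : ℝ → ℝ be even and differentiable, let m ≥ 1, let φ_1, φ_2 ∈ ℝ^m, and suppose that for each y ∈ ℝ^m the function θ ↦ ∑_{j=1}^m L(y_j − θ φ_{1j}) has a unique global minimizer t(y) ∈ ℝ. Then t(−y) = −t(y) for all y ∈ ℝ^m, and consequently the score γ(y) = ∑_{j=1}^m L'(y_j − t(y) φ_{1j}) φ_{2j} satisfies γ(−y) = −γ(y) for all y ∈ ℝ^m. -/
/-- Oddness of the minimizer and of the score: if `L` is even and
differentiable, and `t y` is the unique global minimizer of
`θ ↦ ∑ j L (y j - θ φ₁ j)` for each `y`, then `t (-y) = -t y` and the score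
`γ(y) = ∑ j L'(y j - t y φ₁ j) φ₂ j` satisfies `γ(-y) = -γ(y)`. -/
theorem score_odd_symmetry
    (L : ℝ → ℝ)
    (hEven : ∀ x : ℝ, L (-x) = L x)
    (hDiff : Differentiable ℝ L)
    (m : ℕ) (hm : 1 ≤ m)
    (φ1 φ2 : Fin m → ℝ)
    (t : (Fin m → ℝ) → ℝ)
    (hmin : ∀ y : Fin m → ℝ, ∀ θ : ℝ,
      ∑ j, L (y j - t y * φ1 j) ≤ ∑ j, L (y j - θ * φ1 j))
    (huniq : ∀ y : Fin m → ℝ, ∀ θ : ℝ,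
      (∀ θ' : ℝ, ∑ j, L (y j - θ * φ1 j) ≤ ∑ j, L (y j - θ' * φ1 j)) →
        θ = t y) :
    ∀ y : Fin m → ℝ,
      t (-y) = -t y ∧
        ∑ j, deriv L ((-y) j - t (-y) * φ1 j) * φ2 j =
          -∑ j, deriv L (y j - t y * φ1 j) * φ2 j := by
  intro y
  have key : ∀ θ : ℝ, ∑ j, L ((-y) j - θ * φ1 j) = ∑ j, L (y j - (-θ) * φ1 j) := by
    intro θ
    refine Finset.sum_congr rfl fun j _ => ?_
    rw [← hEven]
    congr 1
    simp only [Pi.neg_apply]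
    ring
  have hodd : ∀ x : ℝ, deriv L (-x) = -deriv L x := by
    intro x
    have h1 : (fun z => L (-z)) = L := funext hEven
    have h2 := deriv_comp_neg L x
    rw [h1] at h2
    linarith
  have ht : t (-y) = -t y := by
    symm
    apply huniq
    intro θ'
    rw [key, key, neg_neg]
    exact hmin y (-θ')
  refine ⟨ht, ?_⟩
  rw [ht, ← Finset.sum_neg_distrib]
  refine Finset.sum_congr rfl fun j _ => ?_
  have h3 : (-y) j - -t y * φ1 j = -(y j - t y * φ1 j) := by
    simp only [Pi.neg_apply]
    ring
  rw [h3, hodd]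
  ring
end

section
/- Let L : ℝ → ℝ satisfy conditions (C1) and (C2) and be continuous, let m ≥ 1 and r ≥ 1, let φ_1, …, φ_r ∈ ℝ^m be orthonormal vectors, and let y ∈ ℝ^m. Then the function g(θ) = ∑_{j=1}^m L(y_j − ∑_{k=1}^r θ_k φ_{kj}) attains its global minimum at some point θ ∈ ℝ^r; moreover, any θ ∈ ℝ^r with g(θ) ≤ g(0) satisfies ∑_{k=1}^r θ_k^2 ≤ 4 m^2 ‖y‖^2, where ‖·‖ is the Euclidean norm on ℝ^m. -/
lemma aux_superadd (L : ℝ → ℝ) (hDiff : Differentiable ℝ L)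
    (hDerivMono : Monotone (deriv L)) (h0 : L 0 = 0) (a b : ℝ) (ha : 0 ≤ a) (hb : 0 ≤ b) :
    L a + L b ≤ L (a + b) := by
  have hd : ∀ x, HasDerivAt (fun x => L (x + b) - L x) (deriv L (x + b) - deriv L x) x := by
    intro x
    exact ((hDiff (x + b)).hasDerivAt.comp_add_const x b).sub (hDiff x).hasDerivAt
  have hmono : Monotone (fun x => L (x + b) - L x) := by
    apply monotone_of_deriv_nonneg (fun x => (hd x).differentiableAt)
    intro x
    rw [(hd x).deriv]
    have := hDerivMono (show x ≤ x + b by linarith)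
    linarith
  have h := hmono ha
  simp only [zero_add, h0] at h
  linarith

lemma aux_sum (L : ℝ → ℝ) (h0 : L 0 = 0)
    (hs : ∀ a b, 0 ≤ a → 0 ≤ b → L a + L b ≤ L (a + b)) {ι : Type*} (s : Finset ι)
    (a : ι → ℝ) (ha : ∀ i, 0 ≤ a i) : ∑ i ∈ s, L (a i) ≤ L (∑ i ∈ s, a i) := by
  classical
  induction s using Finset.induction_on with
  | empty => simp [h0]
  | insert i s hi ih =>
    rw [Finset.sum_insert hi, Finset.sum_insert hi]
    have := hs (a i) (∑ i ∈ s, a i) (ha i) (Finset.sum_nonneg fun i _ => ha i)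
    linarith

/-- Existence of a global minimizer of the robust objective and the sublevel
set bound: for `L` satisfying (C1) and (C2) and being continuous, and
orthonormal `φ_1, …, φ_r`, the objective attains its global minimum, and any
`θ` whose objective value is at most that of `θ = 0` satisfies
`∑ k θ_k² ≤ 4 m² ‖y‖²`. -/
theorem robust_objective_attains_min_and_sublevel_bound
    (L : ℝ → ℝ)
    -- (C1)
    (hEven : ∀ x : ℝ, L (-x) = L x)
    (hNonneg : ∀ x : ℝ, 0 ≤ L x)
    (hZero : ∀ x : ℝ, L x = 0 ↔ x = 0)
    -- (C2)
    (hDiff : Differentiable ℝ L)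
    (hDerivCont : Continuous (deriv L))
    (hDerivMono : Monotone (deriv L))
    (hDerivPos : ∀ x : ℝ, 0 < x → 0 < deriv L x)
    (hCont : Continuous L)
    (m r : ℕ) (hm : 1 ≤ m) (hr : 1 ≤ r)
    (φ : Fin r → EuclideanSpace ℝ (Fin m))
    (hortho : Orthonormal ℝ φ)
    (y : EuclideanSpace ℝ (Fin m)) :
    (∃ θ : Fin r → ℝ, ∀ θ' : Fin r → ℝ,
        ∑ j, L (y j - ∑ k, θ k * φ k j) ≤ ∑ j, L (y j - ∑ k, θ' k * φ k j)) ∧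
      ∀ θ : Fin r → ℝ,
        (∑ j, L (y j - ∑ k, θ k * φ k j) ≤
            ∑ j, L (y j - ∑ k, (0 : ℝ) * φ k j)) →
          ∑ k, (θ k) ^ 2 ≤ 4 * (m : ℝ) ^ 2 * ‖y‖ ^ 2 := by
  have h0 : L 0 = 0 := (hZero 0).2 rfl
  have hs := aux_superadd L hDiff hDerivMono h0
  have hstrict : StrictMonoOn L (Set.Ici 0) := by
    apply strictMonoOn_of_deriv_pos (convex_Ici 0) hCont.continuousOn
    intro x hx
    rw [interior_Ici] at hx
    exact hDerivPos x hx
  have habs : ∀ x, L |x| = L x := by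
    intro x
    rcases abs_choice x with h | h <;> rw [h]
    exact hEven x
  have hbound : ∀ θ : Fin r → ℝ,
        (∑ j, L (y j - ∑ k, θ k * φ k j) ≤
            ∑ j, L (y j - ∑ k, (0 : ℝ) * φ k j)) →
          ∑ k, (θ k) ^ 2 ≤ 4 * (m : ℝ) ^ 2 * ‖y‖ ^ 2 := by
    intro θ hθ
    simp only [zero_mul, Finset.sum_const_zero, sub_zero] at hθ
    set v : EuclideanSpace ℝ (Fin m) := ∑ k, θ k • φ k with hv
    have hvj : ∀ j, v j = ∑ k, θ k * φ k j := by
      intro j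
      simp [hv]
    simp only [← hvj] at hθ
    have hnv : ∑ k, (θ k) ^ 2 = ‖v‖ ^ 2 := by
      rw [← real_inner_self_eq_norm_sq, hv, hortho.inner_sum]
      simp [sq]
    set S := ∑ j, |y j| with hS
    have hS0 : 0 ≤ S := Finset.sum_nonneg fun j _ => abs_nonneg _
    have h1 : ∑ j, L (y j) ≤ L S := by
      have := aux_sum L h0 hs Finset.univ (fun j => |y j|) (fun j => abs_nonneg _)
      simpa only [habs] using this
    have h2 : ∀ j, |y j - v j| ≤ S := by
      intro j
      rw [← hstrict.le_iff_le (Set.mem_Ici.2 (abs_nonneg _)) (Set.mem_Ici.2 hS0), habs]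
      have := Finset.single_le_sum (f := fun j => L (y j - v j))
        (fun j _ => hNonneg _) (Finset.mem_univ j)
      simp only at this
      linarith
    have hyn : ‖y‖ ^ 2 = ∑ j, |y j| ^ 2 := by
      simp [EuclideanSpace.norm_sq_eq]
    have hwn : ‖y - v‖ ^ 2 = ∑ j, |y j - v j| ^ 2 := by
      simp [EuclideanSpace.norm_sq_eq]
    have h3 : S ^ 2 ≤ m * ‖y‖ ^ 2 := by
      rw [hyn]
      have := sq_sum_le_card_mul_sum_sq (s := (Finset.univ : Finset (Fin m))) (f := fun j => |y j|)
      simpa only [Finset.card_univ, Fintype.card_fin] using this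
    have h4 : ‖y - v‖ ^ 2 ≤ m * S ^ 2 := by
      rw [hwn]
      calc ∑ j, |y j - v j| ^ 2 ≤ ∑ _j : Fin m, S ^ 2 :=
            Finset.sum_le_sum fun j _ => pow_le_pow_left₀ (abs_nonneg _) (h2 j) 2
        _ = m * S ^ 2 := by simp
    have hm1 : (1 : ℝ) ≤ m := by exact_mod_cast hm
    have h5 : ‖y - v‖ ≤ m * ‖y‖ := by
      apply le_of_abs_le
      apply abs_le_of_sq_le_sq _ (by positivity)
      have := mul_le_mul_of_nonneg_left h3 (show (0 : ℝ) ≤ m by linarith)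
      nlinarith
    have h6 : ‖v‖ ≤ 2 * m * ‖y‖ := by
      have h7 : ‖v‖ ≤ ‖y‖ + ‖y - v‖ := by
        have := norm_sub_le y (y - v)
        simpa using this
      have := mul_le_mul_of_nonneg_right hm1 (norm_nonneg y)
      linarith
    rw [hnv]
    calc ‖v‖ ^ 2 ≤ (2 * m * ‖y‖) ^ 2 := pow_le_pow_left₀ (norm_nonneg _) h6 2
      _ = _ := by ring
  refine ⟨?_, hbound⟩
  have hgc : Continuous (fun θ : Fin r → ℝ => ∑ j, L (y j - ∑ k, θ k * φ k j)) := by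
    fun_prop
  set R := 2 * (m : ℝ) * ‖y‖ with hR
  have hR0 : 0 ≤ R := by positivity
  obtain ⟨θ, -, hmin⟩ := (isCompact_closedBall (0 : Fin r → ℝ) R).exists_isMinOn
    ⟨0, Metric.mem_closedBall_self hR0⟩ hgc.continuousOn
  refine ⟨θ, fun θ' => ?_⟩
  have hz := hmin (Metric.mem_closedBall_self hR0)
  simp only [Set.mem_ofPred_eq, Pi.zero_apply] at hz
  by_cases h : ∑ j, L (y j - ∑ k, θ' k * φ k j) ≤ ∑ j, L (y j - ∑ k, (0 : ℝ) * φ k j)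
  · apply hmin
    rw [mem_closedBall_zero_iff, pi_norm_le_iff_of_nonneg hR0]
    intro k
    rw [Real.norm_eq_abs]
    apply abs_le_of_sq_le_sq _ hR0
    have h1 := hbound θ' h
    have h2 := Finset.single_le_sum (f := fun k => (θ' k) ^ 2)
      (fun k _ => sq_nonneg _) (Finset.mem_univ k)
    calc (θ' k) ^ 2 ≤ _ := h2.trans h1
      _ = R ^ 2 := by rw [hR]; ring
  · exact hz.trans (le_of_not_ge h)
end
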